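/- Let q be an odd prime power with q ≡ 2 or 3 (mod 5), let c ∈ F_{q^6} satisfy c^2 + c = 1, and let U_c = {(x, x^q + x^{q^3} + c·x^{q^5}) : x ∈ F_{q^6}}. Let s be an integer with 1 ≤ s ≤ 5 and gcd(s, 6) = 1, and let δ ∈ F_{q^6} with δ ≠ 0 and δ^{(q^6−1)/(q−1)} ≠ 1; set U^{2}_{s,δ} = {(x, δ·x^{q^s} + x^{q^{6−s}}) : x ∈ F_{q^6}}. Then for every field automorphism σ of F_{q^6} and every bijective additive map φ : F_{q^6} × F_{q^6} → F_{q^6} × F_{q^6} satisfying φ(λ·v) = σ(λ)·φ(v) for all λ ∈ F_{q^6} and all v, one has { F_{q^6}·φ(u) : u ∈ U_c, u ≠ 0 } ≠ { F_{q^6}·w : w ∈ U^{2}_{s,δ}, w ≠ 0 }. (The linear set L_c is not PΓL(2, q^6)-equivalent to any Lunardon–Polverino type linear set L^{2,6}_{s,δ}.) -/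

import Mathlib

/-- Evaluation at `x` of the `q`-polynomial `∑ aᵢ X ^ (q ^ i)` with six coefficients. -/
def qPolyEval {F : Type*} [Field F] (q : ℕ) (a : Fin 6 → F) (x : F) : F :=
  ∑ i, a i * x ^ (q ^ (i : ℕ))

/-- Coefficients of the `q`-th power of a `q`-polynomial, reduced modulo `X ^ (q ^ 6) - X`. -/
def qPolyShift {F : Type*} [Field F] (q : ℕ) (a : Fin 6 → F) : Fin 6 → F :=
  ![a 5 ^ q, a 0 ^ q, a 1 ^ q, a 2 ^ q, a 3 ^ q, a 4 ^ q]

section QPoly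

variable {F : Type*} [Field F] {q : ℕ}

lemma qPolyEval_pow (hfix : ∀ x : F, x ^ q ^ 6 = x)
    (hadd : ∀ x y : F, (x + y) ^ q = x ^ q + y ^ q) (a : Fin 6 → F) (x : F) :
    qPolyEval q a x ^ q = qPolyEval q (qPolyShift q a) x := by
  simp only [qPolyEval, qPolyShift, Fin.sum_univ_six, hadd, mul_pow, ← pow_mul]
  simp [← pow_succ, hfix]
  ring

lemma qPolyEval_pow_iterate (hfix : ∀ x : F, x ^ q ^ 6 = x)
    (hadd : ∀ x y : F, (x + y) ^ q = x ^ q + y ^ q) (a : Fin 6 → F) (x : F) (k : ℕ) :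
    qPolyEval q a x ^ q ^ k = qPolyEval q ((qPolyShift q)^[k] a) x := by
  induction k with
  | zero => simp
  | succ k ih =>
    rw [pow_succ, pow_mul, ih, qPolyEval_pow hfix hadd, Function.iterate_succ_apply']

lemma qPolyShift_iterate_five (a : Fin 6 → F) :
    (qPolyShift q)^[5] a =
      ![a 1 ^ q ^ 5, a 2 ^ q ^ 5, a 3 ^ q ^ 5, a 4 ^ q ^ 5, a 5 ^ q ^ 5, a 0 ^ q ^ 5] := by
  have h : ∀ x : F, x ^ q ^ 5 = ((((x ^ q) ^ q) ^ q) ^ q) ^ q := by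
    intro x
    simp only [← pow_mul, pow_succ, pow_zero, one_mul]
  simp only [h]
  ext i
  fin_cases i <;> rfl

lemma sum_smul_iterate_qPolyShift {a : Fin 6 → F} (m : Fin 6 → F) (h0 : a 0 = 0)
    (h2 : a 2 = 0) (h3 : a 3 = 0) (h4 : a 4 = 0) :
    ∑ i : Fin 6, a i • (qPolyShift q)^[(i : ℕ)] m =
      a 1 • qPolyShift q m + a 5 • (qPolyShift q)^[5] m := by
  rw [Fin.sum_univ_six, h0, h2, h3, h4]
  simp only [zero_smul, zero_add, add_zero]
  rfl

lemma qPolyEval_comp (hfix : ∀ x : F, x ^ q ^ 6 = x)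
    (hadd : ∀ x y : F, (x + y) ^ q = x ^ q + y ^ q) (a m : Fin 6 → F) (x : F) :
    qPolyEval q a (qPolyEval q m x) =
      qPolyEval q (∑ i : Fin 6, a i • (qPolyShift q)^[(i : ℕ)] m) x := by
  rw [qPolyEval]
  simp only [qPolyEval_pow_iterate hfix hadd]
  simp only [qPolyEval, Finset.sum_apply, Pi.smul_apply, smul_eq_mul, Finset.mul_sum,
    Finset.sum_mul]
  rw [Finset.sum_comm]
  simp only [mul_assoc]

lemma qPolyEval_add (hadd : ∀ x y : F, (x + y) ^ q = x ^ q + y ^ q)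
    (a : Fin 6 → F) (x y : F) :
    qPolyEval q a (x + y) = qPolyEval q a x + qPolyEval q a y := by
  have h : ∀ k : ℕ, (x + y) ^ q ^ k = x ^ q ^ k + y ^ q ^ k := by
    intro k
    induction k with
    | zero => simp
    | succ k ih => simp only [pow_succ, pow_mul, ih, hadd]
  simp only [qPolyEval, h, mul_add, Finset.sum_add_distrib]

/-- The linear map sending a coefficient vector to the function it represents. -/
def qPolyMap (F : Type*) [Field F] (q : ℕ) : (Fin 6 → F) →ₗ[F] (F → F) where
  toFun a := qPolyEval q a
  map_add' a b := by
    ext x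
    simp [qPolyEval, add_mul, Finset.sum_add_distrib]
  map_smul' r a := by
    ext x
    simp [qPolyEval, Finset.mul_sum, mul_assoc]

/-- If a `q`-polynomial `m` induces a surjective map, every `q`-polynomial factors on the right
through `m`. -/
lemma exists_qPolyEval_comp_eq (hfix : ∀ x : F, x ^ q ^ 6 = x)
    (hadd : ∀ x y : F, (x + y) ^ q = x ^ q + y ^ q) (m b : Fin 6 → F)
    (hm : Function.Surjective (qPolyEval q m)) :
    ∃ a : Fin 6 → F, ∀ x, qPolyEval q a (qPolyEval q m x) = qPolyEval q b x := by
  let V := LinearMap.range (qPolyMap F q)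
  let P : (F → F) →ₗ[F] (F → F) := LinearMap.funLeft F F (qPolyEval q m)
  have hP : ∀ v ∈ V, P v ∈ V := by
    rintro _ ⟨a, rfl⟩
    exact ⟨_, (funext fun x => qPolyEval_comp hfix hadd a m x).symm⟩
  have hinj : Function.Injective (P.restrict hP) := by
    intro u v huv
    have h := congrArg Subtype.val huv
    exact Subtype.ext (LinearMap.funLeft_injective_of_surjective F F _ hm h)
  obtain ⟨⟨_, a, rfl⟩, hv⟩ := (LinearMap.injective_iff_surjective.mp hinj)
    ⟨qPolyMap F q b, b, rfl⟩
  exact ⟨a, fun x => congrFun (congrArg Subtype.val hv) x⟩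

end QPoly

section Combinatorics

lemma pow_add_pow_lt {q i j : ℕ} (hq : 3 ≤ q) (hi : i < 6) (hj : j < 6) :
    q ^ i + q ^ j < q ^ 6 - 1 := by
  have h1 : q ^ i ≤ q ^ 5 := Nat.pow_le_pow_right (by omega) (by omega)
  have h2 : q ^ j ≤ q ^ 5 := Nat.pow_le_pow_right (by omega) (by omega)
  have h3 : 3 * q ^ 5 ≤ q ^ 6 := by rw [pow_succ q 5, mul_comm]; gcongr
  have h4 : 3 ^ 5 ≤ q ^ 5 := Nat.pow_le_pow_left hq 5
  omega

lemma pow_modEq_pow {q i k : ℕ} (hq : 3 ≤ q) (hi : i < 6) (hk : k < 6)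
    (h : q ^ i ≡ q ^ k [MOD q ^ 6 - 1]) : i = k := by
  have h1 := pow_add_pow_lt hq hi hi
  have h2 := pow_add_pow_lt hq hk hk
  exact Nat.pow_right_injective (by omega : 2 ≤ q)
    (Nat.ModEq.eq_of_lt_of_lt h (by lia) (by lia) : q ^ i = q ^ k)

lemma pow_add_pow_modEq {q i j k : ℕ} (hq : 3 ≤ q) (hi : i < 6) (hj : j < 6)
    (hk0 : 0 < k) (hk : k ≤ 3) (h : q ^ i + q ^ j ≡ 1 + q ^ k [MOD q ^ 6 - 1]) :
    (i = 0 ∧ j = k) ∨ (i = k ∧ j = 0) := by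
  have h1 := pow_add_pow_lt hq hi hj
  have h2 := pow_add_pow_lt (i := 0) (j := k) hq (by omega) (by omega)
  rw [pow_zero] at h2
  have h := Nat.ModEq.eq_of_lt_of_lt h h1 h2
  have hinj := Nat.pow_right_injective (by omega : 2 ≤ q)
  have hdvd : ∀ e : ℕ, e ≠ 0 → q ∣ q ^ e := fun e he => dvd_pow_self q he
  rcases Nat.eq_zero_or_pos i with rfl | hi0
  · left
    refine ⟨rfl, hinj (?_ : q ^ j = q ^ k)⟩
    simpa using h
  rcases Nat.eq_zero_or_pos j with rfl | hj0
  · right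
    refine ⟨hinj (?_ : q ^ i = q ^ k), rfl⟩
    rw [pow_zero] at h
    omega
  have h3 : q ∣ 1 + q ^ k := h ▸ dvd_add (hdvd i (by omega)) (hdvd j (by omega))
  have h4 := (Nat.dvd_add_left (hdvd k (by omega))).mp h3
  have := Nat.le_of_dvd one_pos h4
  omega

lemma pow_add_pow_add_pow_modEq {q i j l : ℕ} (hq : 3 ≤ q) (hi : i < 6) (hj : j < 6)
    (hl : l < 6) (h : q ^ i + q ^ j + q ^ l ≡ 1 + q + q ^ 2 [MOD q ^ 6 - 1]) :
    i < 3 ∧ j < 3 ∧ l < 3 ∧ i ≠ j ∧ j ≠ l ∧ i ≠ l := by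
  have hle : ∀ e < 6, q ^ e ≤ q ^ 5 := fun e he => Nat.pow_le_pow_right (by omega) (by omega)
  have h1 := hle i hi
  have h2 := hle j hj
  have h3 := hle l hl
  have h4 : 3 * q ^ 5 ≤ q ^ 6 := by rw [pow_succ q 5, mul_comm]; gcongr
  have h5 : 1 + q + q ^ 2 < q ^ 3 := by nlinarith
  have h6 : q ^ 3 ≤ q ^ 5 := hle 3 (by omega)
  have h7 : 3 ^ 5 ≤ q ^ 5 := Nat.pow_le_pow_left hq 5
  have heq : q ^ i + q ^ j + q ^ l = 1 + q + q ^ 2 := by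
    rcases lt_trichotomy (q ^ i + q ^ j + q ^ l) (1 + q + q ^ 2) with hlt | heq | hgt
    · have := Nat.le_of_dvd (by omega) ((Nat.modEq_iff_dvd' hlt.le).mp h)
      omega
    · exact heq
    · have := Nat.le_of_dvd (by omega) ((Nat.modEq_iff_dvd' hgt.le).mp h.symm)
      omega
  have hlt : ∀ e : ℕ, q ^ e ≤ 1 + q + q ^ 2 → e < 3 := by
    intro e he
    by_contra hc
    have : q ^ 3 ≤ q ^ e := Nat.pow_le_pow_right (by omega) (by omega)
    omega
  have hi3 := hlt i (by omega)
  have hj3 := hlt j (by omega)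
  have hl3 := hlt l (by omega)
  have hq2 : 3 * q ≤ q ^ 2 := by nlinarith
  interval_cases i <;> interval_cases j <;> interval_cases l <;>
    (try simp only [pow_zero, pow_one] at heq) <;> first | decide | (exfalso; nlinarith)

end Combinatorics

section PowerSums

variable {F : Type*} [Field F] [Fintype F] {q : ℕ}

/-- Character sums detect congruence of exponents modulo the order of `Fˣ`. -/
lemma sum_units_pow_mul_inv_pow (hcard : Fintype.card F = q ^ 6) [DecidableEq F] (e d : ℕ) :
    ∑ x : Fˣ, (x : F) ^ e * ((x : F) ^ d)⁻¹ = if e ≡ d [MOD q ^ 6 - 1] then -1 else 0 := by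
  have hN : Fintype.card F - 1 = q ^ 6 - 1 := by rw [hcard]
  have hx : ∀ x : Fˣ, x ^ (q ^ 6 - 1) = 1 := by
    intro x
    rw [← hN, ← Fintype.card_units]
    exact pow_card_eq_one
  have hN0 : 0 < q ^ 6 - 1 := by
    have := Fintype.one_lt_card (α := F)
    omega
  set N := q ^ 6 - 1
  have hterm : ∀ x : Fˣ, (x : F) ^ e * ((x : F) ^ d)⁻¹ = (x : F) ^ (e + (N - 1) * d) := by
    intro x
    have h1 : (x : F) ^ ((N - 1) * d) * (x : F) ^ d = 1 := by
      rw [← pow_add]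
      have : (N - 1) * d + d = N * d := by
        obtain ⟨M, hM⟩ : ∃ M, N = M + 1 := ⟨N - 1, by omega⟩
        rw [hM]; simp; ring
      rw [this, pow_mul]
      have := congrArg (fun u : Fˣ => (u : F)) (hx x)
      simp only [Units.val_pow_eq_pow_val, Units.val_one] at this
      rw [this, one_pow]
    rw [pow_add]
    congr 1
    exact (eq_inv_of_mul_eq_one_left h1).symm
  simp only [hterm]
  rw [FiniteField.sum_pow_units, hN]
  congr 1
  apply propext
  rw [← Nat.modEq_zero_iff_dvd]
  have h2 : d + (N - 1) * d ≡ 0 [MOD N] := by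
    rw [Nat.modEq_zero_iff_dvd]
    refine ⟨d, ?_⟩
    obtain ⟨M, hM⟩ : ∃ M, N = M + 1 := ⟨N - 1, by omega⟩
    rw [hM]; simp; ring
  constructor
  · intro h
    exact Nat.ModEq.add_right_cancel' _ (h.trans h2.symm)
  · intro h
    exact (h.add_right _).trans h2

lemma sum_qPolyEval_div_pow (hq : 3 ≤ q) (hcard : Fintype.card F = q ^ 6) [DecidableEq F]
    (a : Fin 6 → F) (k : Fin 6) :
    ∑ x : Fˣ, qPolyEval q a x * ((x : F) ^ q ^ (k : ℕ))⁻¹ = -a k := by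
  simp only [qPolyEval, Finset.sum_mul, mul_assoc]
  rw [Finset.sum_comm]
  simp only [← Finset.mul_sum, sum_units_pow_mul_inv_pow hcard]
  rw [Finset.sum_eq_single k]
  · simp [Nat.ModEq.refl]
  · intro i _ hik
    rw [if_neg, mul_zero]
    exact fun h => hik (Fin.ext (pow_modEq_pow hq i.2 k.2 h))
  · simp

lemma sum_qPolyEval_mul_qPolyEval (hq : 3 ≤ q) (hcard : Fintype.card F = q ^ 6) [DecidableEq F]
    (a b : Fin 6 → F) (k : Fin 6) (hk0 : 0 < k) (hk : k ≤ 3) :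
    ∑ x : Fˣ, qPolyEval q a x * qPolyEval q b x * ((x : F) ^ (1 + q ^ (k : ℕ)))⁻¹ =
      -(a 0 * b k + a k * b 0) := by
  have h1 : ∀ x : Fˣ, qPolyEval q a x * qPolyEval q b x * ((x : F) ^ (1 + q ^ (k : ℕ)))⁻¹ =
      ∑ i, ∑ j, a i * b j * ((x : F) ^ (q ^ (i : ℕ) + q ^ (j : ℕ)) *
        ((x : F) ^ (1 + q ^ (k : ℕ)))⁻¹) := by
    intro x
    rw [qPolyEval, qPolyEval, Finset.sum_mul_sum, Finset.sum_mul]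
    refine Finset.sum_congr rfl fun i _ => ?_
    rw [Finset.sum_mul]
    refine Finset.sum_congr rfl fun j _ => ?_
    rw [pow_add (x : F) (q ^ (i : ℕ))]
    ring
  have h2 : ∀ i j : Fin 6, (q ^ (i : ℕ) + q ^ (j : ℕ) ≡ 1 + q ^ (k : ℕ) [MOD q ^ 6 - 1]) ↔
      (i = 0 ∧ j = k) ∨ (i = k ∧ j = 0) := by
    intro i j
    constructor
    · intro h
      have := pow_add_pow_modEq hq i.2 j.2 (by simpa using hk0) (Fin.le_def.mp hk) h
      simp only [Fin.ext_iff]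
      exact this
    · rintro (⟨rfl, rfl⟩ | ⟨rfl, rfl⟩)
      · simp [Nat.ModEq.refl]
      · simp [Nat.ModEq.refl, add_comm]
  simp only [h1]
  rw [Finset.sum_comm]
  simp only [Finset.sum_comm (s := (Finset.univ : Finset Fˣ))]
  simp only [← Finset.mul_sum, sum_units_pow_mul_inv_pow hcard, h2]
  clear h1 h2
  have : k = 1 ∨ k = 2 ∨ k = 3 := by
    revert hk0 hk; revert k; decide
  rcases this with rfl | rfl | rfl <;> simp [Fin.sum_univ_six] <;> ring

lemma sum_qPolyEval_mul_qPolyEval_mul_qPolyEval (hq : 3 ≤ q)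
    (hcard : Fintype.card F = q ^ 6) [DecidableEq F] (a b c : Fin 6 → F) :
    ∑ x : Fˣ, qPolyEval q a x * qPolyEval q b x * qPolyEval q c x *
        ((x : F) ^ (1 + q + q ^ 2))⁻¹ =
      -(a 0 * b 1 * c 2 + a 0 * b 2 * c 1 + a 1 * b 0 * c 2 + a 1 * b 2 * c 0 +
        a 2 * b 0 * c 1 + a 2 * b 1 * c 0) := by
  have h1 : ∀ x : Fˣ, qPolyEval q a x * qPolyEval q b x * qPolyEval q c x *
      ((x : F) ^ (1 + q + q ^ 2))⁻¹ =
      ∑ i, ∑ j, ∑ l, a i * b j * c l *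
        ((x : F) ^ (q ^ (i : ℕ) + q ^ (j : ℕ) + q ^ (l : ℕ)) *
          ((x : F) ^ (1 + q + q ^ 2))⁻¹) := by
    intro x
    rw [qPolyEval, qPolyEval, qPolyEval, Finset.sum_mul_sum, Finset.sum_mul, Finset.sum_mul]
    refine Finset.sum_congr rfl fun i _ => ?_
    rw [Finset.sum_mul, Finset.sum_mul]
    refine Finset.sum_congr rfl fun j _ => ?_
    rw [Finset.mul_sum, Finset.sum_mul]
    refine Finset.sum_congr rfl fun l _ => ?_
    rw [pow_add (x : F) (q ^ (i : ℕ) + q ^ (j : ℕ)), pow_add (x : F) (q ^ (i : ℕ))]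
    ring
  have h2 : ∀ i j l : Fin 6,
      (q ^ (i : ℕ) + q ^ (j : ℕ) + q ^ (l : ℕ) ≡ 1 + q + q ^ 2 [MOD q ^ 6 - 1]) ↔
      i < 3 ∧ j < 3 ∧ l < 3 ∧ i ≠ j ∧ j ≠ l ∧ i ≠ l := by
    intro i j l
    constructor
    · intro h
      have := pow_add_pow_add_pow_modEq hq i.2 j.2 l.2 h
      simp only [Fin.lt_def, ne_eq, Fin.ext_iff]
      exact this
    · intro h
      have h3 : q ^ (i : ℕ) + q ^ (j : ℕ) + q ^ (l : ℕ) = 1 + q + q ^ 2 := by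
        fin_cases i <;> fin_cases j <;> fin_cases l <;>
          first
          | exact absurd h (by decide)
          | (simp; try ring)
      rw [h3]
  simp only [h1]
  simp only [Finset.sum_comm (s := (Finset.univ : Finset Fˣ))]
  simp only [← Finset.mul_sum, sum_units_pow_mul_inv_pow hcard, h2]
  simp [Fin.sum_univ_six]
  ring

lemma qPolyEval_injective (hq : 3 ≤ q) (hcard : Fintype.card F = q ^ 6)
    {a b : Fin 6 → F} (h : ∀ x, qPolyEval q a x = qPolyEval q b x) : a = b := by
  classical
  ext k
  have ha := sum_qPolyEval_div_pow hq hcard a k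
  simp only [h] at ha
  exact neg_injective (ha.symm.trans (sum_qPolyEval_div_pow hq hcard b k))

/-- Every nonempty fibre of `u ↦ f u / u`, for `f` additive, has cardinality `-1` in `F`. -/
lemma card_fiber_div_eq_neg_one [DecidableEq F] {f : F → F}
    (hf : ∀ x y, f (x + y) = f x + f y) (v : Fˣ) :
    ((Finset.univ.filter fun u : Fˣ => f u / u = f v / v).card : F) = -1 := by
  set m := f v / v
  let g : F →+ F := AddMonoidHom.mk' f hf - AddMonoidHom.mulLeft m
  have hg : ∀ x : F, g x = f x - m * x := fun x => rfl
  have hmem : ∀ u : Fˣ, (u : F) ∈ g.ker ↔ f u / u = m := by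
    intro u
    rw [AddMonoidHom.mem_ker, hg, sub_eq_zero, div_eq_iff u.ne_zero]
  have h0 : ((Nat.card g.ker : ℕ) : F) = 0 := by
    have hv : (v : F) ∈ g.ker := (hmem v).mpr rfl
    have h := congrArg Subtype.val (card_nsmul_eq_zero' (x := (⟨v, hv⟩ : g.ker)))
    simp only [AddSubgroup.coe_nsmul, AddSubgroup.coe_zero, nsmul_eq_mul] at h
    exact (mul_eq_zero.mp h).resolve_right v.ne_zero
  have hcard : Nat.card g.ker = (Finset.univ.filter fun u : Fˣ => f u / u = m).card + 1 := by
    have h1 : (Finset.univ.filter fun x : F => x ∈ g.ker) = insert 0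
        ((Finset.univ.filter fun u : Fˣ => f u / u = m).image fun u : Fˣ => (u : F)) := by
      ext x
      simp only [Finset.mem_filter, Finset.mem_univ, true_and, Finset.mem_insert,
        Finset.mem_image]
      constructor
      · intro hx
        by_cases hx0 : x = 0
        · exact Or.inl hx0
        · exact Or.inr ⟨Units.mk0 x hx0, (hmem (Units.mk0 x hx0)).mp hx, rfl⟩
      · rintro (rfl | ⟨u, hu, rfl⟩)
        · exact zero_mem _
        · exact (hmem u).mpr hu
    rw [Nat.card_eq_fintype_card, Fintype.card_subtype, h1, Finset.card_insert_of_notMem,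
      Finset.card_image_of_injective _ Units.val_injective]
    simp
  rw [hcard] at h0
  push_cast at h0
  exact eq_neg_of_add_eq_zero_left h0

/-- Two additive functions with the same set of quotients `f u / u` have the same power sums. -/
lemma sum_div_eq_of_range_eq [DecidableEq F] {f g : F → F}
    (hf : ∀ x y, f (x + y) = f x + f y) (hg : ∀ x y, g (x + y) = g x + g y)
    (hrange : Set.range (fun u : Fˣ => f u / u) = Set.range (fun u : Fˣ => g u / u))
    (G : F → F) : ∑ u : Fˣ, G (f u / u) = ∑ u : Fˣ, G (g u / u) := by
  have key : ∀ {k : F → F}, (∀ x y, k (x + y) = k x + k y) → ∑ u : Fˣ, G (k u / u) =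
      ∑ m ∈ Finset.univ.image (fun u : Fˣ => k u / u), -G m := by
    intro k hk
    rw [Finset.sum_comp G (fun u : Fˣ => k u / u)]
    refine Finset.sum_congr rfl fun m hm => ?_
    obtain ⟨v, -, rfl⟩ := Finset.mem_image.mp hm
    rw [nsmul_eq_mul, card_fiber_div_eq_neg_one hk v, neg_one_mul]
  have himage : Finset.univ.image (fun u : Fˣ => f u / u) =
      Finset.univ.image (fun u : Fˣ => g u / u) := by
    apply Finset.coe_injective
    simpa using hrange
  rw [key hf, key hg, himage]

/-- A `q`-polynomial with the same quotients as a Lunardon–Polverino binomial is supported on the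
same two exponents. -/
lemma support_of_range_eq (hq : 3 ≤ q) (hcard : Fintype.card F = q ^ 6)
    (hadd : ∀ x y : F, (x + y) ^ q = x ^ q + y ^ q) {a b : Fin 6 → F}
    (hrange : Set.range (fun u : Fˣ => qPolyEval q a u / u) =
      Set.range (fun u : Fˣ => qPolyEval q b u / u))
    (hb0 : b 0 = 0) (hb2 : b 2 = 0) (hb3 : b 3 = 0) (hb4 : b 4 = 0) (hb1 : b 1 ≠ 0)
    (hb5 : b 5 ≠ 0) :
    a 0 = 0 ∧ a 2 = 0 ∧ a 3 = 0 ∧ a 4 = 0 ∧ a 1 ≠ 0 ∧ a 5 ≠ 0 := by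
  classical
  have hfix : ∀ x : F, x ^ q ^ 6 = x := fun x => hcard ▸ FiniteField.pow_card x
  have hqne : q ≠ 0 := by omega
  have hsum := sum_div_eq_of_range_eq (qPolyEval_add hadd a) (qPolyEval_add hadd b) hrange
  have h1 : ∀ e : Fin 6 → F, ∑ u : Fˣ, qPolyEval q e u / u = -e 0 := by
    intro e
    simpa [div_eq_mul_inv] using sum_qPolyEval_div_pow hq hcard e 0
  have h2 : ∀ (e : Fin 6 → F) (k : Fin 6), 0 < k → k ≤ 3 →
      ∑ u : Fˣ, (qPolyEval q e u / u) ^ (1 + q ^ (k : ℕ)) =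
        -(e 0 * (qPolyShift q)^[(k : ℕ)] e k + e k * (qPolyShift q)^[(k : ℕ)] e 0) := by
    intro e k hk0 hk
    rw [← sum_qPolyEval_mul_qPolyEval hq hcard e _ k hk0 hk]
    refine Finset.sum_congr rfl fun u _ => ?_
    rw [div_pow, pow_add (qPolyEval q e u), pow_one, qPolyEval_pow_iterate hfix hadd,
      div_eq_mul_inv]
  have h3 : ∀ e : Fin 6 → F, ∑ u : Fˣ, (qPolyEval q e u / u) ^ (1 + q + q ^ 2) =
      -(e 0 * (qPolyShift q)^[1] e 1 * (qPolyShift q)^[2] e 2 +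
        e 0 * (qPolyShift q)^[1] e 2 * (qPolyShift q)^[2] e 1 +
        e 1 * (qPolyShift q)^[1] e 0 * (qPolyShift q)^[2] e 2 +
        e 1 * (qPolyShift q)^[1] e 2 * (qPolyShift q)^[2] e 0 +
        e 2 * (qPolyShift q)^[1] e 0 * (qPolyShift q)^[2] e 1 +
        e 2 * (qPolyShift q)^[1] e 1 * (qPolyShift q)^[2] e 0) := by
    intro e
    rw [← sum_qPolyEval_mul_qPolyEval_mul_qPolyEval hq hcard e ((qPolyShift q)^[1] e)
      ((qPolyShift q)^[2] e)]
    refine Finset.sum_congr rfl fun u _ => ?_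
    rw [← qPolyEval_pow_iterate hfix hadd, ← qPolyEval_pow_iterate hfix hadd, div_pow, pow_one,
      pow_add (qPolyEval q e u), pow_add (qPolyEval q e u), pow_one, div_eq_mul_inv]
  have e0 := hsum id
  simp only [id_eq, h1, hb0, neg_zero, neg_eq_zero] at e0
  have e1 := hsum (fun t => t ^ (1 + q ^ ((1 : Fin 6) : ℕ)))
  have e2 := hsum (fun t => t ^ (1 + q ^ ((2 : Fin 6) : ℕ)))
  have e3 := hsum (fun t => t ^ (1 + q ^ ((3 : Fin 6) : ℕ)))
  have e4 := hsum (fun t => t ^ (1 + q + q ^ 2))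
  simp only [h2 _ 1 (by decide) (by decide), h2 _ 2 (by decide) (by decide),
    h2 _ 3 (by decide) (by decide), h3] at e1 e2 e3 e4
  simp [qPolyShift, e0, hb0, hb2, hb3, hb4, hqne] at e1 e2 e3 e4
  have h15 : a 1 * a 5 ^ q ≠ 0 := e1 ▸ mul_ne_zero hb1 (pow_ne_zero _ hb5)
  have ha1 := left_ne_zero_of_mul h15
  have ha5 : a 5 ≠ 0 := fun h => right_ne_zero_of_mul h15 (by rw [h, zero_pow hqne])
  rcases e2 with h | h <;> simp_all

end PowerSums

lemma add_pow_of_card_eq_pow {F : Type*} [Field F] [Fintype F] {q e : ℕ} (hq : IsPrimePow q)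
    (hcard : Fintype.card F = q ^ e) (x y : F) : (x + y) ^ q = x ^ q + y ^ q := by
  obtain ⟨p, k, hp, hk, rfl⟩ := hq
  rw [← Nat.prime_iff] at hp
  obtain ⟨r, hr⟩ := CharP.exists F
  obtain ⟨n, hrp, hrn⟩ := FiniteField.card F r
  have hdvd : r ∣ p := by
    apply hrp.dvd_of_dvd_pow (n := k * e)
    rw [pow_mul, ← hcard, hrn]
    exact dvd_pow_self r n.pos.ne'
  obtain rfl := (Nat.prime_dvd_prime_iff_eq hrp hp).mp hdvd
  have := Fact.mk hrp
  exact add_pow_char_pow x y r k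

theorem stmt16 (q : ℕ) (hq : IsPrimePow q) (hodd : Odd q)
    (hq5 : q % 5 = 2 ∨ q % 5 = 3)
    (F : Type*) [Field F] [Fintype F] (hcard : Fintype.card F = q ^ 6)
    (c : F) (hc : c ^ 2 + c = 1)
    (Uc : Set (F × F))
    (hUc : Uc = {p : F × F | ∃ x : F, p = (x, x ^ q + x ^ (q ^ 3) + c * x ^ (q ^ 5))})
    (s : ℕ) (hs1 : 1 ≤ s) (hs5 : s ≤ 5) (hsgcd : Nat.gcd s 6 = 1)
    (δ : F) (hδ0 : δ ≠ 0) (hδN : δ ^ ((q ^ 6 - 1) / (q - 1)) ≠ 1)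
    (U2 : Set (F × F))
    (hU2 : U2 = {p : F × F | ∃ x : F, p = (x, δ * x ^ (q ^ s) + x ^ (q ^ (6 - s)))}) :
    ∀ (σ : F ≃+* F) (φ : F × F → F × F),
      Function.Bijective φ →
      (∀ v w : F × F, φ (v + w) = φ v + φ w) →
      (∀ (l : F) (v : F × F), φ (l • v) = σ l • φ v) →
      ({W : Submodule F (F × F) | ∃ u ∈ Uc, u ≠ 0 ∧ W = Submodule.span F {φ u}} :
          Set (Submodule F (F × F)))
        ≠ {W : Submodule F (F × F) | ∃ w ∈ U2, w ≠ 0 ∧ W = Submodule.span F {w}} := by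
  intro σ φ _ hφadd hφsmul hL
  have hq3 : 3 ≤ q := by
    obtain ⟨k, rfl⟩ := hodd
    omega
  have hqne : q ≠ 0 := by omega
  have hfix : ∀ x : F, x ^ q ^ 6 = x := fun x => hcard ▸ FiniteField.pow_card x
  have hadd := add_pow_of_card_eq_pow hq hcard
  obtain ⟨b, hb0, hb2, hb3, hb4, hb1, hb5, hb⟩ : ∃ b : Fin 6 → F, b 0 = 0 ∧ b 2 = 0 ∧ b 3 = 0 ∧
      b 4 = 0 ∧ b 1 ≠ 0 ∧ b 5 ≠ 0 ∧
      ∀ x, δ * x ^ (q ^ s) + x ^ (q ^ (6 - s)) = qPolyEval q b x := by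
    have hs : s = 1 ∨ s = 5 := by interval_cases s <;> simp_all
    rcases hs with rfl | rfl
    · refine ⟨![0, δ, 0, 0, 0, 1], ?_⟩
      simp [qPolyEval, Fin.sum_univ_six, hδ0]
    · refine ⟨![0, 1, 0, 0, 0, δ], ?_⟩
      simp [qPolyEval, Fin.sum_univ_six, hδ0, add_comm]
  set A := (φ (1, 0)).1
  set C := (φ (1, 0)).2
  set B := (φ (0, 1)).1
  set D := (φ (0, 1)).2
  set m : Fin 6 → F := ![A, B, 0, B, 0, B * σ c]
  set n : Fin 6 → F := ![C, D, 0, D, 0, D * σ c]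
  have hφ : ∀ x : F, φ (x, x ^ q + x ^ (q ^ 3) + c * x ^ (q ^ 5)) =
      (qPolyEval q m (σ x), qPolyEval q n (σ x)) := by
    intro x
    have h : ∀ y z : F, φ (y, z) = (σ y * A + σ z * B, σ y * C + σ z * D) := by
      intro y z
      have hyz : (y, z) = y • ((1 : F), (0 : F)) + z • ((0 : F), (1 : F)) := by simp
      rw [hyz, hφadd, hφsmul, hφsmul]
      rfl
    rw [h]
    simp [qPolyEval, Fin.sum_univ_six, m, n]
    constructor <;> ring
  have hUc' : ∀ x : F, x ≠ 0 → ∃ y : F, y ≠ 0 ∧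
      Submodule.span F {(qPolyEval q m x, qPolyEval q n x)} =
        Submodule.span F {(y, qPolyEval q b y)} := by
    intro x hx
    have hmem : Submodule.span F {(qPolyEval q m x, qPolyEval q n x)} ∈
        {W : Submodule F (F × F) | ∃ u ∈ Uc, u ≠ 0 ∧ W = Submodule.span F {φ u}} := by
      refine ⟨_, by rw [hUc]; exact ⟨σ.symm x, rfl⟩, ?_, ?_⟩
      · simp [Prod.ext_iff, hx]
      · rw [hφ, σ.apply_symm_apply]
    rw [hL] at hmem
    obtain ⟨w, hw, hw0, hW⟩ := hmem
    rw [hU2] at hw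
    obtain ⟨y, rfl⟩ := hw
    rw [hb] at hW
    refine ⟨y, ?_, hW⟩
    rintro rfl
    exact hw0 (by simp [hqne])
  have hU2' : ∀ y : F, y ≠ 0 → ∃ x : F, x ≠ 0 ∧
      Submodule.span F {(qPolyEval q m x, qPolyEval q n x)} =
        Submodule.span F {(y, qPolyEval q b y)} := by
    intro y hy
    have hmem : Submodule.span F {(y, qPolyEval q b y)} ∈
        {W : Submodule F (F × F) | ∃ w ∈ U2, w ≠ 0 ∧ W = Submodule.span F {w}} := by
      refine ⟨_, by rw [hU2]; exact ⟨y, rfl⟩, ?_, ?_⟩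
      · simp [Prod.ext_iff, hy]
      · rw [hb]
    rw [← hL] at hmem
    obtain ⟨u, hu, hu0, hW⟩ := hmem
    rw [hUc] at hu
    obtain ⟨x, rfl⟩ := hu
    rw [hφ] at hW
    refine ⟨σ x, ?_, hW.symm⟩
    rw [map_ne_zero]
    rintro rfl
    exact hu0 (by simp [hqne])
  have hspan : ∀ {x y : F} (_ : y ≠ 0),
      Submodule.span F {(qPolyEval q m x, qPolyEval q n x)} =
        Submodule.span F {(y, qPolyEval q b y)} →
      qPolyEval q m x ≠ 0 ∧
        qPolyEval q n x / qPolyEval q m x = qPolyEval q b y / y := by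
    intro x y hy h
    have hmem : (y, qPolyEval q b y) ∈
        Submodule.span F {(qPolyEval q m x, qPolyEval q n x)} :=
      h ▸ Submodule.mem_span_singleton_self _
    obtain ⟨r, hr⟩ := Submodule.mem_span_singleton.mp hmem
    simp only [Prod.smul_mk, smul_eq_mul, Prod.mk.injEq] at hr
    have hr0 : r * qPolyEval q m x ≠ 0 := hr.1 ▸ hy
    refine ⟨right_ne_zero_of_mul hr0, ?_⟩
    rw [← hr.2, ← hr.1, mul_div_mul_left _ _ (left_ne_zero_of_mul hr0)]
  have hm0 : ∀ x, x ≠ 0 → qPolyEval q m x ≠ 0 := by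
    intro x hx
    obtain ⟨y, hy, h⟩ := hUc' x hx
    exact (hspan hy h).1
  have hmsurj : Function.Surjective (qPolyEval q m) := by
    apply Finite.injective_iff_surjective.mp
    have hinj : Function.Injective (AddMonoidHom.mk' (qPolyEval q m) (qPolyEval_add hadd m)) := by
      rw [injective_iff_map_eq_zero]
      intro x hx
      by_contra hx0
      exact hm0 x hx0 hx
    exact hinj
  obtain ⟨a, ha⟩ := exists_qPolyEval_comp_eq hfix hadd m n hmsurj
  have hrange : Set.range (fun u : Fˣ => qPolyEval q a u / u) =
      Set.range (fun u : Fˣ => qPolyEval q b u / u) := by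
    ext t
    constructor
    · rintro ⟨u, rfl⟩
      obtain ⟨x, hx⟩ := hmsurj u
      have hx0 : x ≠ 0 := by
        rintro rfl
        exact u.ne_zero (by rw [← hx]; simp [qPolyEval, hqne])
      obtain ⟨y, hy, h⟩ := hUc' x hx0
      refine ⟨Units.mk0 y hy, ?_⟩
      simp only [Units.val_mk0]
      rw [← (hspan hy h).2, ← hx, ha]
    · rintro ⟨u, rfl⟩
      obtain ⟨x, hx0, h⟩ := hU2' u u.ne_zero
      obtain ⟨hmx, hquot⟩ := hspan u.ne_zero h
      refine ⟨Units.mk0 _ hmx, ?_⟩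
      simp only [Units.val_mk0]
      rw [ha, hquot]
  obtain ⟨a0, a2, a3, a4, a1, a5⟩ :=
    support_of_range_eq hq3 hcard hadd hrange hb0 hb2 hb3 hb4 hb1 hb5
  have hcoeff : a 1 • qPolyShift q m + a 5 • (qPolyShift q)^[5] m = n := by
    rw [← sum_smul_iterate_qPolyShift m a0 a2 a3 a4]
    apply qPolyEval_injective hq3 hcard
    intro x
    rw [← qPolyEval_comp hfix hadd, ha]
  rw [qPolyShift_iterate_five] at hcoeff
  have c1 : a 1 * A ^ q + a 5 * 0 ^ q ^ 5 = D := congrFun hcoeff 1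
  have c2 : a 1 * B ^ q + a 5 * B ^ q ^ 5 = 0 := congrFun hcoeff 2
  have c3 : a 1 * 0 ^ q + a 5 * 0 ^ q ^ 5 = D := congrFun hcoeff 3
  have c4 : a 1 * B ^ q + a 5 * (B * σ c) ^ q ^ 5 = 0 := congrFun hcoeff 4
  simp only [zero_pow hqne, zero_pow (pow_ne_zero 5 hqne), mul_zero, add_zero] at c1 c3
  have hA0 : A = 0 := by
    rw [← c3] at c1
    exact eq_zero_of_pow_eq_zero ((mul_eq_zero.mp c1).resolve_left a1)
  have hB0 : B ≠ 0 := by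
    intro hB0
    apply hm0 1 one_ne_zero
    simp [qPolyEval, Fin.sum_univ_six, m, hA0, hB0]
  have hσc : σ c = 1 := by
    have hpow : σ c ^ q ^ 5 = 1 := by
      have h : a 5 * B ^ q ^ 5 * (σ c ^ q ^ 5 - 1) = 0 := by
        rw [mul_pow] at c4
        linear_combination c4 - c2
      exact sub_eq_zero.mp ((mul_eq_zero.mp h).resolve_left
        (mul_ne_zero a5 (pow_ne_zero _ hB0)))
    rw [← hfix (σ c), pow_succ q 5, pow_mul, hpow, one_pow]
  have hc1 : c = 1 := by simpa using hσc
  rw [hc1] at hc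
  simp at hc
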